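/- Let a_2, a_3, …, a_9 be nonzero complex numbers satisfying D_{i,j} = 0 for the pairs (i,j) ∈ {(2,3), (2,4), (2,5), (2,6), (2,7), (3,4), (3,5), (3,6), (4,5)}, where D_{i,j} := (j−i) a_{i+j} − (j−1) a_i a_{j+1} + (i−1) a_{i+1} a_j. Then a_3 = a_2² and a_4 = a_2³. -/

import Mathlib

/-- The case `a 2 = 1`, with `x, y, b₅, …, b₉` standing for `a 3, a 4, …, a 9`. -/
theorem eq_one_of_normalized {x y b₅ b₆ b₇ b₈ b₉ : ℂ} (hx : x ≠ 0) (hy : y ≠ 0)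
    (h23 : b₅ - 2 * y + x * x = 0)
    (h24 : 2 * b₆ - 3 * b₅ + x * y = 0)
    (h25 : 3 * b₇ - 4 * b₆ + x * b₅ = 0)
    (h26 : 4 * b₈ - 5 * b₇ + x * b₆ = 0)
    (h27 : 5 * b₉ - 6 * b₈ + x * b₇ = 0)
    (h34 : b₇ - 3 * x * b₅ + 2 * y * y = 0)
    (h35 : 2 * b₈ - 4 * x * b₆ + 2 * y * b₅ = 0)
    (h45 : b₉ - 4 * y * b₆ + 3 * b₅ * b₅ = 0) :
    x = 1 ∧ y = 1 := by
  obtain ⟨s, rfl⟩ : ∃ s, y = x * s := ⟨y / x, by field_simp⟩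
  have hs : s ≠ 0 := right_ne_zero_of_mul hy
  obtain rfl : b₅ = 2 * (x * s) - x ^ 2 := by linear_combination h23
  obtain rfl : b₆ = (3 * (2 * (x * s) - x ^ 2) - x ^ 2 * s) / 2 := by
    linear_combination h24 / 2
  obtain rfl : b₇ = 3 * x * (2 * (x * s) - x ^ 2) - 2 * (x * s) ^ 2 := by
    linear_combination h34
  have h₁ : 6 * s + x * (3 * s ^ 2 - 11 * s - 3) + 5 * x ^ 2 = 0 := by
    apply mul_left_cancel₀ hx
    linear_combination -h25 / 2
  have h₂ : x * (s - 3) = 4 * s ^ 2 - 6 * s := by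
    apply mul_left_cancel₀ (pow_ne_zero 2 hx)
    linear_combination -2 * (h26 - 2 * h35)
  have hprod : (2 * s - 1) * (s - 1) = 0 := by
    have h : 6 * s ^ 3 * ((2 * s - 1) * (s - 1)) = 0 := by
      linear_combination (s - 3) ^ 2 * h₁ -
        ((s - 3) * (3 * s ^ 2 - 11 * s - 3) + 5 * (x * (s - 3) + 4 * s ^ 2 - 6 * s)) * h₂
    exact (mul_eq_zero.mp h).resolve_left (by simp [hs])
  rcases mul_eq_zero.mp hprod with h | h
  · obtain rfl : s = 1 / 2 := by linear_combination h / 2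
    obtain rfl : x = 4 / 5 := by linear_combination -2 / 5 * h₂
    exfalso
    have hcontra : (1 : ℂ) = 0 := by
      linear_combination (h27 - 5 * h45 + 3 * h35) * (-625 / 48)
    exact one_ne_zero hcontra
  · obtain rfl : s = 1 := by linear_combination h
    obtain rfl : x = 1 := by linear_combination -h₂ / 2
    simp

/-- Let `a₂, a₃, …, a₉` be nonzero complex numbers satisfying `D_{i,j} = 0` for the
pairs `(i,j) ∈ {(2,3), (2,4), (2,5), (2,6), (2,7), (3,4), (3,5), (3,6), (4,5)}`, where
`D_{i,j} := (j−i) a_{i+j} − (j−1) a_i a_{j+1} + (i−1) a_{i+1} a_j`.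
Then `a₃ = a₂²` and `a₄ = a₂³`. -/
theorem a3_a4_determined (a : ℕ → ℂ)
    (ha : ∀ k : ℕ, 2 ≤ k → k ≤ 9 → a k ≠ 0)
    (hD : ∀ i j : ℕ,
      (i, j) ∈ ({(2,3), (2,4), (2,5), (2,6), (2,7),
                 (3,4), (3,5), (3,6), (4,5)} : Set (ℕ × ℕ)) →
      ((j : ℂ) - (i : ℂ)) * a (i + j) - ((j : ℂ) - 1) * a i * a (j + 1)
        + ((i : ℂ) - 1) * a (i + 1) * a j = 0) :
    a 3 = a 2 ^ 2 ∧ a 4 = a 2 ^ 3 := by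
  have h2 : a 2 ≠ 0 := ha 2 le_rfl (by norm_num)
  obtain ⟨b, hb⟩ : ∃ b : ℕ → ℂ, ∀ k, a k = a 2 ^ (k - 1) * b k :=
    ⟨fun k => a k / a 2 ^ (k - 1), fun k => by field_simp⟩
  have hb2 : b 2 = 1 := by
    have h := hb 2
    apply mul_left_cancel₀ h2
    linear_combination -h
  have hne : ∀ k, 2 ≤ k → k ≤ 9 → b k ≠ 0 := fun k hk hk' h =>
    ha k hk hk' (by rw [hb k, h, mul_zero])
  have hDb : ∀ i j : ℕ, 2 ≤ i → 2 ≤ j →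
      (i, j) ∈ ({(2,3), (2,4), (2,5), (2,6), (2,7),
                 (3,4), (3,5), (3,6), (4,5)} : Set (ℕ × ℕ)) →
      ((j : ℂ) - (i : ℂ)) * b (i + j) - ((j : ℂ) - 1) * b i * b (j + 1)
        + ((i : ℂ) - 1) * b (i + 1) * b j = 0 := by
    intro i j hi hj hij
    have h := hD i j hij
    rw [hb (i + j), hb i, hb j, hb (i + 1), hb (j + 1)] at h
    obtain ⟨i, rfl⟩ := Nat.exists_eq_add_of_le' hi
    obtain ⟨j, rfl⟩ := Nat.exists_eq_add_of_le' hj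
    have e : i + 2 + (j + 2) - 1 = i + j + 3 := by omega
    simp only [e, Nat.add_sub_cancel, Nat.add_succ_sub_one] at h
    apply mul_left_cancel₀ (pow_ne_zero (i + j + 3) h2)
    linear_combination h
  have h23 := hDb 2 3 (by norm_num) (by norm_num) (by simp)
  have h24 := hDb 2 4 (by norm_num) (by norm_num) (by simp)
  have h25 := hDb 2 5 (by norm_num) (by norm_num) (by simp)
  have h26 := hDb 2 6 (by norm_num) (by norm_num) (by simp)
  have h27 := hDb 2 7 (by norm_num) (by norm_num) (by simp)
  have h34 := hDb 3 4 (by norm_num) (by norm_num) (by simp)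
  have h35 := hDb 3 5 (by norm_num) (by norm_num) (by simp)
  have h45 := hDb 4 5 (by norm_num) (by norm_num) (by simp)
  norm_num [hb2] at h23 h24 h25 h26 h27 h34 h35 h45
  obtain ⟨h3, h4⟩ := eq_one_of_normalized (hne 3 (by norm_num) (by norm_num))
    (hne 4 (by norm_num) (by norm_num)) (b₅ := b 5) (b₆ := b 6) (b₇ := b 7) (b₈ := b 8)
    (b₉ := b 9) (by linear_combination h23) (by linear_combination h24)
    (by linear_combination h25) (by linear_combination h26) (by linear_combination h27)
    (by linear_combination h34) (by linear_combination h35) (by linear_combination h45)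
  rw [hb 3, hb 4, h3, h4]
  simp
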